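/- Let Γ ⊂ P^n_K (n ≥ 2) be a generic set of n + 2 points in P^n. Then hyp(Γ) = n, d(Γ) = 2, and the minimum socle degree satisfies A_n = 2, so d(Γ) = A_n. -/

import Mathlib

open MvPolynomial

noncomputable section

namespace PointsMinDist

variable {K : Type} [Field K]

/-- The (homogeneous) vanishing ideal of a set of points of projective space:
all polynomials vanishing at every representative vector of every point. -/
def vanishingIdeal {m : ℕ} (Γ : Set (Projectivization K (Fin m → K))) :
    Ideal (MvPolynomial (Fin m) K) where
  carrier := {f | ∀ P ∈ Γ, ∀ (v : Fin m → K) (hv : v ≠ 0),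
      Projectivization.mk K v hv = P → MvPolynomial.eval v f = 0}
  zero_mem' := by intro P hP v hv h; simp
  add_mem' := by
    intro f g hf hg P hP v hv h
    simp [hf P hP v hv h, hg P hP v hv h]
  smul_mem' := by
    intro c f hf P hP v hv h
    simp [smul_eq_mul, hf P hP v hv h]

/-- The degree-`d` graded component of a (homogeneous) ideal, as a `K`-subspace. -/
def degPart {m : ℕ} (I : Ideal (MvPolynomial (Fin m) K)) (d : ℕ) :
    Submodule K (MvPolynomial (Fin m) K) :=
  Submodule.restrictScalars K I ⊓ homogeneousSubmodule (Fin m) K d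

/-- `K`-dimension of the degree-`d` component of an ideal. -/
def hdim {m : ℕ} (I : Ideal (MvPolynomial (Fin m) K)) (d : ℕ) : ℕ :=
  Module.finrank K (degPart I d)

/-- Hilbert function of `R/I` in degree `d`. -/
def HF {m : ℕ} (I : Ideal (MvPolynomial (Fin m) K)) (d : ℕ) : ℕ :=
  Module.finrank K (homogeneousSubmodule (Fin m) K d) - hdim I d

open Classical in
/-- `hyp Γ`: the maximum number of points of `Γ` contained in a hyperplane. -/
def hyp {m : ℕ} (Γ : Finset (Projectivization K (Fin m → K))) : ℕ :=
  sSup {k | ∃ φ : Module.Dual K (Fin m → K), φ ≠ 0 ∧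
    k = (Γ.filter fun P => φ P.rep = 0).card}

/-- the minimum distance `d(Γ) = |Γ| - hyp(Γ)`. -/
def minDist {m : ℕ} (Γ : Finset (Projectivization K (Fin m → K))) : ℕ :=
  Γ.card - hyp Γ

/-- `Γ` is non-degenerate: it is not contained in any hyperplane. -/
def Nondeg {m : ℕ} (Γ : Finset (Projectivization K (Fin m → K))) : Prop :=
  ∀ φ : Module.Dual K (Fin m → K), (∀ P ∈ Γ, φ P.rep = 0) → φ = 0

/-- The higher minimum distance `d(Γ)ₐ = |Γ| - max{|Γ'| : Γ' ⊆ Γ, dim I(Γ')ₐ > dim I(Γ)ₐ}`. -/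
def higherD {m : ℕ} (Γ : Finset (Projectivization K (Fin m → K))) (a : ℕ) : ℕ :=
  Γ.card - sSup {k | ∃ Γ' ⊆ Γ,
    hdim (vanishingIdeal (Γ' : Set (Projectivization K (Fin m → K)))) a >
      hdim (vanishingIdeal (Γ : Set (Projectivization K (Fin m → K)))) a ∧ k = Γ'.card}

open Classical in
/-- The degree `δ(P)` of a point `P` in `Γ`: the least degree in which the ideal
of `Γ \ {P}` is strictly bigger than the ideal of `Γ`. -/
def pointDegree {m : ℕ} (Γ : Finset (Projectivization K (Fin m → K)))
    (P : Projectivization K (Fin m → K)) : ℕ :=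
  sInf {d | hdim (vanishingIdeal ((Γ.erase P) : Set (Projectivization K (Fin m → K)))) d >
    hdim (vanishingIdeal (Γ : Set (Projectivization K (Fin m → K)))) d}

/-- A graded minimal free resolution
`0 → F_len → ⋯ → F_1 → R → R/I → 0` of `R/I`, `R = K[x_0,…,x_{N-1}]`.
`F_j = ⊕_{i : Fin (rk j)} R(-(twist j i))` for `1 ≤ j ≤ len`.
The differential `F_1 → R` is given by `gen` (so that its image is `I`) and the
differential `F_{j+2} → F_{j+1}` is given (in matrix form, rows indexed by the
target) by `mat j`.  All entries are homogeneous of the appropriate degrees, and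
minimality means all entries lie in the irrelevant maximal ideal
(zero constant coefficient). -/
structure MinFreeRes (N : ℕ) (K : Type) [Field K] (I : Ideal (MvPolynomial (Fin N) K)) where
  len : ℕ
  rk : ℕ → ℕ
  twist : (j : ℕ) → Fin (rk j) → ℕ
  gen : Fin (rk 1) → MvPolynomial (Fin N) K
  mat : (j : ℕ) → Matrix (Fin (rk (j + 1))) (Fin (rk (j + 2))) (MvPolynomial (Fin N) K)
  rk_len_pos : 0 < rk len
  rk_eq_zero : ∀ j, len < j → rk j = 0
  gen_hom : ∀ i, (gen i).IsHomogeneous (twist 1 i)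
  gen_min : ∀ i, constantCoeff (gen i) = 0
  gen_span : Ideal.span (Set.range gen) = I
  mat_hom : ∀ j i i', mat j i i' = 0 ∨
    ∃ d, (mat j i i').IsHomogeneous d ∧ d + twist (j + 1) i = twist (j + 2) i'
  mat_min : ∀ j i i', constantCoeff (mat j i i') = 0
  exact_one : ∀ v : Fin (rk 1) → MvPolynomial (Fin N) K,
    (∑ i, v i * gen i = 0) ↔ v ∈ LinearMap.range (mat 0).mulVecLin
  exact_rest : ∀ j, LinearMap.ker (mat j).mulVecLin = LinearMap.range (mat (j + 1)).mulVecLin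

/-- `a(Γ)`: the minimal twist `min_i {a_i}` occurring in the last module
`F_len = ⊕ R(-a_i)` of the minimal free resolution. -/
def MinFreeRes.aMin {N : ℕ} {K : Type} [Field K] {I : Ideal (MvPolynomial (Fin N) K)}
    (res : MinFreeRes N K I) : ℕ :=
  Finset.univ.inf'
    (Finset.univ_nonempty_iff.mpr (Fin.pos_iff_nonempty.mp res.rk_len_pos))
    (fun i => res.twist res.len i)

/-- The minimum socle degree `A_n = min_i {a_i - n}` (here `n = len`, the length of
the resolution). -/
def MinFreeRes.A {N : ℕ} {K : Type} [Field K] {I : Ideal (MvPolynomial (Fin N) K)}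
    (res : MinFreeRes N K I) : ℤ :=
  (res.aMin : ℤ) - res.len



/-! ### Koszul complex on functions on finsets -/

section Koszul

variable {R : Type*} [CommRing R] {M : Type*} [AddCommGroup M] [Module R M]
  {M' : Type*} [AddCommGroup M'] [Module R M'] {N : ℕ}

/-- The sign of `i` relative to `S`. -/
def sg (i : Fin N) (S : Finset (Fin N)) : ℤ := (-1) ^ (S.filter (· < i)).card

lemma sg_mul_self (i : Fin N) (S : Finset (Fin N)) : sg i S * sg i S = 1 := by
  unfold sg
  rw [← pow_add, ← two_mul, pow_mul]; simp

lemma sg_insert (i j : Fin N) (S : Finset (Fin N)) (hj : j ∉ S) :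
    sg i (insert j S) = (if j < i then -1 else 1) * sg i S := by
  unfold sg
  rw [Finset.filter_insert]
  split_ifs with h
  · rw [Finset.card_insert_of_notMem (by simp [hj]), pow_succ]; ring
  · simp

lemma sg_erase (i j : Fin N) (S : Finset (Fin N)) (hj : j ∈ S) :
    sg i S = (if j < i then -1 else 1) * sg i (S.erase j) := by
  conv_lhs => rw [← Finset.insert_erase hj]
  exact sg_insert i j _ (Finset.notMem_erase j S)

/-- Contraction. -/
def ann (R : Type*) [CommRing R] {M : Type*} [AddCommGroup M] [Module R M] {N : ℕ} (i : Fin N) :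
    (Finset (Fin N) → M) →ₗ[R] (Finset (Fin N) → M) where
  toFun w S := if i ∈ S then 0 else sg i S • w (insert i S)
  map_add' v w := by ext S; by_cases h : i ∈ S <;> simp [h]
  map_smul' c w := by
    ext S; by_cases h : i ∈ S
    · simp [h]
    · simp only [h, if_false, Pi.smul_apply, RingHom.id_apply]
      exact smul_comm _ _ _

/-- Exterior multiplication. -/
def cre (R : Type*) [CommRing R] {M : Type*} [AddCommGroup M] [Module R M] {N : ℕ} (i : Fin N) :
    (Finset (Fin N) → M) →ₗ[R] (Finset (Fin N) → M) where
  toFun w S := if i ∈ S then sg i S • w (S.erase i) else 0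
  map_add' v w := by ext S; by_cases h : i ∈ S <;> simp [h]
  map_smul' c w := by
    ext S; by_cases h : i ∈ S
    · simp only [h, if_true, Pi.smul_apply, RingHom.id_apply]
      exact smul_comm _ _ _
    · simp [h]

lemma ann_apply (i : Fin N) (w : Finset (Fin N) → M) (S : Finset (Fin N)) :
    ann R i w S = if i ∈ S then 0 else sg i S • w (insert i S) := rfl

lemma cre_apply (i : Fin N) (w : Finset (Fin N) → M) (S : Finset (Fin N)) :
    cre R i w S = if i ∈ S then sg i S • w (S.erase i) else 0 := rfl

lemma ann_ann (i j : Fin N) (w : Finset (Fin N) → M) :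
    ann R i (ann R j w) = - ann R j (ann R i w) := by
  ext S
  simp only [ann_apply, Pi.neg_apply]
  by_cases hi : i ∈ S
  · simp [hi]
  by_cases hj : j ∈ S
  · simp [hj]
  by_cases hij : i = j
  · subst hij; simp
  have hji : ¬ j = i := fun h => hij h.symm
  simp only [hi, hj, if_false, Finset.mem_insert, hij, hji, or_self, smul_smul]
  rw [sg_insert j i S hi, sg_insert i j S hj, Finset.insert_comm, ← neg_smul]
  congr 1
  rcases lt_or_gt_of_ne hij with h | h
  · simp [h, not_lt_of_gt h]; ring
  · simp [h, not_lt_of_gt h]; ring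

lemma ann_cre_self (i : Fin N) (w : Finset (Fin N) → M) :
    ann R i (cre R i w) + cre R i (ann R i w) = w := by
  ext S
  simp only [ann_apply, cre_apply, Pi.add_apply]
  by_cases hi : i ∈ S
  · have := sg_erase i i S hi
    simp only [lt_irrefl, if_false, one_mul] at this
    simp [hi, smul_smul, ← this, sg_mul_self]
  · have := sg_insert i i S hi
    simp only [lt_irrefl, if_false, one_mul] at this
    simp [hi, smul_smul, this, sg_mul_self]

lemma ann_cre_ne (i j : Fin N) (hij : i ≠ j) (w : Finset (Fin N) → M) :
    ann R i (cre R j w) + cre R j (ann R i w) = 0 := by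
  ext S
  simp only [ann_apply, cre_apply, Pi.add_apply, Pi.zero_apply]
  by_cases hi : i ∈ S
  · simp [hi, hij]
  by_cases hj : j ∈ S
  · have e : (insert i S).erase j = insert i (S.erase j) := by
      rw [Finset.erase_insert_of_ne hij]
    simp only [hi, hj, if_false, if_true, Finset.mem_insert, Finset.mem_erase, or_true, and_false,
      smul_smul, e]
    rw [sg_insert j i S hi, sg_erase i j S hj, ← add_smul]
    convert zero_smul ℤ _
    rcases lt_or_gt_of_ne hij with h | h
    · simp [h, not_lt_of_gt h]; ring
    · simp [h, not_lt_of_gt h]; ring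
  · simp [hi, hj, hij.symm]

lemma cre_ann_self_apply (i : Fin N) (w : Finset (Fin N) → M) (S : Finset (Fin N)) :
    cre R i (ann R i w) S = if i ∈ S then w S else 0 := by
  simp only [ann_apply, cre_apply]
  by_cases hi : i ∈ S
  · have := sg_erase i i S hi
    simp only [lt_irrefl, if_false, one_mul] at this
    simp [hi, smul_smul, ← this, sg_mul_self]
  · simp [hi]

lemma ann_map (f : M →ₗ[R] M') (i : Fin N) (w : Finset (Fin N) → M) :
    ann R i (fun S => f (w S)) = fun S => f (ann R i w S) := by
  ext S
  simp only [ann_apply]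
  split_ifs <;> simp

end Koszul

section KoszulPoly

variable {N : ℕ} {M : Type*} [AddCommGroup M] [Module (MvPolynomial (Fin N) K) M]
  {M' : Type*} [AddCommGroup M'] [Module (MvPolynomial (Fin N) K) M']

local notation "𝓡" => MvPolynomial (Fin N) K

/-- Koszul differential. -/
def kd (K : Type) [Field K] {N : ℕ} {M : Type*} [AddCommGroup M]
    [Module (MvPolynomial (Fin N) K) M] :
    (Finset (Fin N) → M) →ₗ[MvPolynomial (Fin N) K] (Finset (Fin N) → M) :=
  ∑ i, (X i : MvPolynomial (Fin N) K) • ann (MvPolynomial (Fin N) K) i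

lemma kd_eq (w : Finset (Fin N) → M) :
    kd K w = ∑ i, (X i : 𝓡) • ann 𝓡 i w := by
  simp [kd]

lemma kd_apply (w : Finset (Fin N) → M) (S : Finset (Fin N)) :
    kd K w S = ∑ i, (X i : 𝓡) • ann 𝓡 i w S := by
  rw [kd_eq]; simp

lemma kd_map (f : M →ₗ[𝓡] M') (w : Finset (Fin N) → M) :
    kd K (fun S => f (w S)) = fun S => f (kd K w S) := by
  ext S
  simp [kd_apply, ann_map]

lemma kd_kd [CharZero K] (w : Finset (Fin N) → M) : kd K (kd K w) = 0 := by
  have h : kd K (kd K w) = - kd K (kd K w) := by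
    conv_lhs => rw [kd_eq]
    conv_rhs => rw [kd_eq]
    simp only [kd_eq w, map_sum, map_smul, Finset.smul_sum, smul_smul]
    conv_lhs => rw [Finset.sum_comm]
    rw [← Finset.sum_neg_distrib]
    refine Finset.sum_congr rfl fun i _ => ?_
    rw [← Finset.sum_neg_distrib]
    refine Finset.sum_congr rfl fun j _ => ?_
    rw [ann_ann, smul_neg, mul_comm]
  have h2 : (2 : 𝓡) • kd K (kd K w) = 0 := by
    rw [two_smul]; nth_rewrite 1 [h]; exact neg_add_cancel _
  have h3 : (C (2⁻¹ : K) : 𝓡) * 2 = 1 := by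
    have : (2 : 𝓡) = C (2 : K) := (map_ofNat C 2).symm
    rw [this, ← C_mul]; simp
  calc kd K (kd K w) = ((C (2⁻¹ : K) : 𝓡) * 2) • kd K (kd K w) := by rw [h3, one_smul]
    _ = 0 := by rw [mul_smul, h2, smul_zero]

lemma kd_cre (j : Fin N) (w : Finset (Fin N) → M) :
    kd K (cre 𝓡 j w) + cre 𝓡 j (kd K w) = (X j : 𝓡) • w := by
  rw [kd_eq, kd_eq, map_sum, ← Finset.sum_add_distrib, Finset.sum_eq_single j]
  · rw [map_smul, ← smul_add, ann_cre_self]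
  · intro i _ hi
    rw [map_smul, ← smul_add, ann_cre_ne i j hi, smul_zero]
  · simp

/-- Coefficientwise partial derivative. -/
def pd (j : Fin N) (w : Finset (Fin N) → 𝓡) : Finset (Fin N) → 𝓡 := fun S => pderiv j (w S)

/-- de Rham differential. -/
def dR (w : Finset (Fin N) → 𝓡) : Finset (Fin N) → 𝓡 := ∑ j, cre 𝓡 j (pd j w)

lemma pd_kd (j : Fin N) (w : Finset (Fin N) → 𝓡) :
    pd j (kd K w) = ann 𝓡 j w + kd K (pd j w) := by
  ext1 S
  simp only [pd, Pi.add_apply, kd_apply, map_sum, smul_eq_mul, Derivation.leibniz]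
  rw [Finset.sum_add_distrib, add_comm]
  congr 1
  · rw [Finset.sum_eq_single j]
    · simp
    · intro i _ hi; rw [pderiv_X_of_ne hi, mul_zero]
    · simp
  · refine Finset.sum_congr rfl fun i _ => ?_
    simp only [ann_apply]
    split_ifs <;> simp [pd]

lemma homotopy (w : Finset (Fin N) → 𝓡) (S : Finset (Fin N)) :
    kd K (dR w) S + dR (kd K w) S = ∑ i, X i * pderiv i (w S) + (S.card : 𝓡) * w S := by
  have : kd K (dR w) + dR (kd K w)
      = ∑ j, ((X j : 𝓡) • pd j w + cre 𝓡 j (ann 𝓡 j w)) := by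
    unfold dR
    rw [map_sum, ← Finset.sum_add_distrib]
    refine Finset.sum_congr rfl fun j _ => ?_
    rw [pd_kd, map_add, ← kd_cre]; abel
  rw [← Pi.add_apply, this]
  simp only [Finset.sum_apply, Pi.add_apply, Finset.sum_add_distrib, cre_ann_self_apply]
  congr 1
  rw [Finset.sum_ite_mem]
  simp

/-- `f` is zero or homogeneous of degree `a - s`. -/
def Wt (f : 𝓡) (s a : ℕ) : Prop := f = 0 ∨ ∃ d, f.IsHomogeneous d ∧ d + s = a

lemma Wt.zero (s a : ℕ) : Wt (0 : 𝓡) s a := Or.inl rfl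

lemma Wt.add {f g : 𝓡} {s a : ℕ} (hf : Wt f s a) (hg : Wt g s a) : Wt (f + g) s a := by
  rcases hf with rfl | ⟨d, hd, h⟩
  · simpa using hg
  rcases hg with rfl | ⟨e, he, h'⟩
  · rw [add_zero]; exact Or.inr ⟨d, hd, h⟩
  obtain rfl : d = e := by omega
  exact Or.inr ⟨d, hd.add he, h⟩

lemma Wt.sum {ι : Type*} (t : Finset ι) (f : ι → 𝓡) {s a : ℕ} (hf : ∀ i ∈ t, Wt (f i) s a) :
    Wt (∑ i ∈ t, f i) s a := by
  classical
  induction t using Finset.induction_on with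
  | empty => simpa using Wt.zero s a
  | insert i t hi ih =>
    rw [Finset.sum_insert hi]
    exact (hf i (by simp)).add (ih fun j hj => hf j (by simp [hj]))

lemma Wt.C_mul {f : 𝓡} {s a : ℕ} (hf : Wt f s a) (c : K) : Wt (C c * f) s a := by
  rcases hf with rfl | ⟨d, hd, h⟩
  · left; simp
  · exact Or.inr ⟨d, hd.C_mul c, h⟩

lemma Wt.zsmul {f : 𝓡} {s a : ℕ} (hf : Wt f s a) (c : ℤ) : Wt (c • f) s a := by
  have : c • f = C (c : K) * f := by simp
  rw [this]; exact hf.C_mul _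

lemma Wt.pderiv {f : 𝓡} {s a : ℕ} (hf : Wt f s a) (j : Fin N) :
    Wt (pderiv j f) (s + 1) a := by
  rcases hf with rfl | ⟨d, hd, h⟩
  · left; simp
  · rcases Nat.eq_zero_or_pos d with rfl | hpos
    · left
      rw [← totalDegree_zero_iff_isHomogeneous, totalDegree_eq_zero_iff_eq_C] at hd
      rw [hd, pderiv_C]
    · exact Or.inr ⟨d - 1, hd.pderiv, by omega⟩

lemma koszul_exact [CharZero K] (w : Finset (Fin N) → 𝓡) (s a p : ℕ)
    (hw : ∀ S, Wt (w S) (S.card + s) a) (hsupp : ∀ S, S.card ≠ p → w S = 0)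
    (hc : constantCoeff (w ∅) = 0) (hk : kd K w = 0) :
    ∃ y : Finset (Fin N) → 𝓡, (∀ S, Wt (y S) (S.card + s) a) ∧
      (∀ S, S.card ≠ p + 1 → y S = 0) ∧ kd K y = w := by
  let c : K := (((a : ℤ) - s : ℤ) : K)
  refine ⟨(C c⁻¹ : 𝓡) • dR w, ?_, ?_, ?_⟩
  · intro S
    simp only [Pi.smul_apply, smul_eq_mul, dR, Finset.sum_apply, cre_apply]
    apply Wt.C_mul
    apply Wt.sum
    intro i _
    split_ifs with hi
    · apply Wt.zsmul
      have := (hw (S.erase i)).pderiv i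
      have e : (S.erase i).card + s + 1 = S.card + s := by
        have := Finset.card_erase_add_one hi; omega
      rw [e] at this
      exact this
    · exact Wt.zero _ _
  · intro S hS
    simp only [Pi.smul_apply, smul_eq_mul, dR, Finset.sum_apply, cre_apply]
    rw [Finset.sum_eq_zero, mul_zero]
    intro i _
    split_ifs with hi
    · have := Finset.card_erase_add_one hi
      simp only [pd]
      rw [hsupp _ (by omega)]; simp
    · rfl
  · ext1 S
    rw [map_smul]
    have h := homotopy w S
    rw [hk] at h
    have h0 : dR (0 : Finset (Fin N) → 𝓡) S = 0 := by
      have : ∀ j, pd j (0 : Finset (Fin N) → 𝓡) = 0 := fun j => by ext1 S; simp [pd]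
      simp [dR, this]
    rw [h0, add_zero] at h
    rw [Pi.smul_apply, h, smul_eq_mul]
    rcases hw S with h1 | ⟨d, hd, h1⟩
    · simp [h1]
    · rw [hd.sum_X_mul_pderiv, nsmul_eq_mul, ← add_mul, ← mul_assoc]
      have ec : ((d : 𝓡) + (S.card : 𝓡)) = C c := by
        have : c = (d : K) + S.card := by
          simp only [c]; rw [← h1]; push_cast; ring
        rw [this]; simp
      rw [ec, ← C_mul]
      by_cases hc0 : c = 0
      · have hz : d = 0 ∧ S.card = 0 := by
          have : ((a : ℤ) - s : ℤ) = 0 := Int.cast_eq_zero.mp hc0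
          omega
        obtain ⟨rfl, h2⟩ := hz
        rw [Finset.card_eq_zero] at h2
        subst h2
        rw [← totalDegree_zero_iff_isHomogeneous, totalDegree_eq_zero_iff_eq_C] at hd
        rw [constantCoeff_eq] at hc
        rw [hd, hc]; simp
      · rw [inv_mul_cancel₀ hc0]; simp

end KoszulPoly

section Step

variable {N : ℕ}

local notation "𝓡" => MvPolynomial (Fin N) K

/-- Vanishing of the Koszul homology in weight `a`. -/
def KH {ι : Type} (U : Submodule 𝓡 (ι → 𝓡)) (t : ι → ℕ) (a p : ℕ) : Prop :=
  ∀ z : Finset (Fin N) → (ι → 𝓡), (∀ S, z S ∈ U) → (∀ S, S.card ≠ p → z S = 0) →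
    (∀ S i, Wt (z S i) (S.card + t i) a) → kd K z = 0 →
    ∃ w : Finset (Fin N) → (ι → 𝓡), (∀ S, w S ∈ U) ∧ kd K w = z

lemma koszul_exact_vec [CharZero K] {ι : Type} (t : ι → ℕ) (a p : ℕ)
    (z : Finset (Fin N) → (ι → 𝓡)) (hsupp : ∀ S, S.card ≠ p → z S = 0)
    (hw : ∀ S i, Wt (z S i) (S.card + t i) a)
    (hc : ∀ i, constantCoeff (z ∅ i) = 0) (hk : kd K z = 0) :
    ∃ y : Finset (Fin N) → (ι → 𝓡), (∀ S i, Wt (y S i) (S.card + t i) a) ∧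
      (∀ S, S.card ≠ p + 1 → y S = 0) ∧ kd K y = z := by
  have key : ∀ i : ι, ∃ y : Finset (Fin N) → 𝓡, (∀ S, Wt (y S) (S.card + t i) a) ∧
      (∀ S, S.card ≠ p + 1 → y S = 0) ∧ kd K y = fun S => z S i := by
    intro i
    refine koszul_exact (fun S => z S i) (t i) a p (fun S => hw S i)
      (fun S hS => by simp [hsupp S hS]) (hc i) ?_
    have := kd_map (K := K) (LinearMap.proj (R := 𝓡) (φ := fun _ : ι => 𝓡) i) z
    simp only [LinearMap.proj_apply] at this
    rw [this, hk]; rfl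
  choose y hy1 hy2 hy3 using key
  refine ⟨fun S i => y i S, fun S i => hy1 i S, fun S hS => funext fun i => hy2 i S hS, ?_⟩
  ext1 S; ext1 i
  have := kd_map (K := K) (LinearMap.proj (R := 𝓡) (φ := fun _ : ι => 𝓡) i) (fun S i => y i S)
  simp only [LinearMap.proj_apply] at this
  have h2 := congrFun this S
  rw [← h2]
  exact congrFun (hy3 i) S

lemma KH_step [CharZero K] {ι κ : Type} (D : (κ → 𝓡) →ₗ[𝓡] (ι → 𝓡)) (t : ι → ℕ) (t' : κ → ℕ)
    (a p : ℕ)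
    (hD : ∀ (y : κ → 𝓡) (s : ℕ), (∀ k, Wt (y k) (s + t' k) a) → ∀ i, Wt (D y i) (s + t i) a)
    (hmin : ∀ y ∈ LinearMap.ker D, ∀ k, constantCoeff (y k) = 0)
    (h : KH (LinearMap.range D) t a (p + 1)) : KH (LinearMap.ker D) t' a p := by
  intro z hzU hsupp hw hk
  obtain ⟨y, hy1, hy2, hy3⟩ := koszul_exact_vec t' a p z hsupp hw (hmin _ (hzU ∅)) hk
  obtain ⟨w', hw'U, hw'⟩ := h (fun S => D (y S)) (fun S => ⟨_, rfl⟩)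
    (fun S hS => by simp [hy2 S hS]) (fun S => hD _ _ (hy1 S)) (by
      rw [kd_map, hy3]; ext1 S; exact hzU S)
  choose w hw2 using hw'U
  have ew : w' = fun S => D (w S) := funext fun S => (hw2 S).symm
  refine ⟨y - kd K w, fun S => ?_, ?_⟩
  · rw [ew, kd_map] at hw'
    rw [LinearMap.mem_ker, Pi.sub_apply, map_sub, sub_eq_zero]
    exact (congrFun hw' S).symm
  · rw [map_sub, kd_kd, sub_zero, hy3]

lemma cre_mem (U : Ideal 𝓡) (w : Finset (Fin N) → 𝓡) (h : ∀ S, w S ∈ U) (j : Fin N) (S) :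
    cre 𝓡 j w S ∈ U := by
  rw [cre_apply]
  split_ifs
  · exact zsmul_mem (h _) _
  · exact zero_mem _

lemma kd_univ (w : Finset (Fin N) → 𝓡) : kd K w Finset.univ = 0 := by
  simp [kd_apply, ann_apply]

end Step

section Base

variable {n : ℕ}

local notation "𝓡" => MvPolynomial (Fin (n + 1)) K

/-- `Unit`-indexed copy of an ideal. -/
def unitSub (I : Ideal 𝓡) : Submodule 𝓡 (Unit → 𝓡) :=
  Submodule.comap (LinearMap.proj (R := 𝓡) (φ := fun _ : Unit => 𝓡) ()) I

lemma KH_base [CharZero K] (I : Ideal 𝓡) (a p : ℕ) (hp : p + 1 = n)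
    (hI0 : ∀ f ∈ I, constantCoeff f = 0)
    (hI : ∀ f : Fin (n + 1) → 𝓡, (∀ i, Wt (f i) n a) →
      (∀ i j, X i * f j - X j * f i ∈ I) → ∃ g, ∀ i, X i * g - f i ∈ I) :
    KH (unitSub I) (fun _ => 0) a p := by
  intro z hzU hsupp hw hk
  have hz' : kd K (fun S => z S ()) = 0 := by
    have := kd_map (K := K) (LinearMap.proj (R := 𝓡) (φ := fun _ : Unit => 𝓡) ()) z
    simp only [LinearMap.proj_apply] at this
    rw [this, hk]; rfl
  obtain ⟨y, hy1, hy2, hy3⟩ := koszul_exact (fun S => z S ()) 0 a p (fun S => hw S ())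
    (fun S hS => by simp [hsupp S hS]) (hI0 _ (hzU ∅)) hz'
  have hcard : ∀ i : Fin (n + 1), (Finset.univ.erase i).card = n := by
    intro i; simp
  obtain ⟨g, hg⟩ := hI (fun i => cre 𝓡 i y Finset.univ) (by
      intro i
      simp only [cre_apply, Finset.mem_univ, if_true]
      apply Wt.zsmul
      have := hy1 (Finset.univ.erase i)
      rwa [hcard, add_zero] at this) (by
      intro i j
      have h1 := kd_cre (K := K) i y
      have h2 := kd_cre (K := K) j (cre 𝓡 i y)
      have h3 : kd K (cre 𝓡 i y) = (X i : 𝓡) • y - cre 𝓡 i (kd K y) := by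
        rw [← h1]; abel
      rw [h3, map_sub, map_smul] at h2
      have h4 := congrFun h2 Finset.univ
      simp only [Pi.add_apply, Pi.sub_apply, Pi.smul_apply, kd_univ, zero_add, smul_eq_mul] at h4
      have h5 : X i * cre 𝓡 j y Finset.univ - X j * cre 𝓡 i y Finset.univ
          = cre 𝓡 j (cre 𝓡 i (kd K y)) Finset.univ := by
        rw [← h4]; ring
      rw [h5]
      refine cre_mem I _ (fun S => cre_mem I _ (fun S => ?_) _ _) _ _
      rw [hy3]; exact hzU S)
  let η : Finset (Fin (n + 1)) → 𝓡 := fun S => if S = Finset.univ then g else 0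
  refine ⟨fun S _ => y S - kd K η S, fun S => ?_, ?_⟩
  · change y S - kd K η S ∈ I
    by_cases hS : S.card = n
    · obtain ⟨i, hi⟩ : ∃ i, S = Finset.univ.erase i := by
        have : Sᶜ.card = 1 := by rw [Finset.card_compl]; simp [hS]
        obtain ⟨i, hi⟩ := Finset.card_eq_one.mp this
        refine ⟨i, ?_⟩
        rw [← compl_compl S, hi]; ext x; simp
      have h1 := congrFun (kd_cre (K := K) i η) Finset.univ
      rw [Pi.add_apply, kd_univ, zero_add] at h1
      have h2 := hg i
      have h3 : (X i : 𝓡) * g = ((X i : 𝓡) • η) Finset.univ := by simp [η]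
      rw [h3, ← h1] at h2
      simp only [cre_apply, Finset.mem_univ, if_true, ← hi] at h2
      rw [← smul_sub] at h2
      have h4 := zsmul_mem h2 (-(sg i Finset.univ))
      rw [smul_smul, neg_mul, sg_mul_self] at h4
      simpa using h4
    · rw [hy2 S (by omega), zero_sub, neg_mem_iff, kd_apply]
      rw [Finset.sum_eq_zero]
      · exact zero_mem _
      intro i _
      rw [ann_apply]
      split_ifs with hi
      · simp
      · have : insert i S ≠ Finset.univ := by
          intro h
          have h2 := congrArg Finset.card h
          rw [Finset.card_insert_of_notMem hi] at h2
          simp at h2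
          exact hS h2
        simp [η, this]
  · ext1 S; ext1 u
    have := kd_map (K := K) (LinearMap.proj (R := 𝓡) (φ := fun _ : Unit => 𝓡) u)
      (fun S _ => y S - kd K η S)
    simp only [LinearMap.proj_apply] at this
    rw [← congrFun this S]
    change kd K (y - kd K η) S = _
    rw [map_sub, kd_kd, sub_zero, hy3]

end Base

section Res

variable {n : ℕ}

lemma main_res [CharZero K] {I : Ideal (MvPolynomial (Fin (n + 1)) K)}
    (res : MinFreeRes (n + 1) K I) {k : ℕ} (hnk : n = k + 2) (hlen : res.len = k + 2)
    (e : Fin (res.rk (k + 2)))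
    (hI : ∀ f : Fin (n + 1) → MvPolynomial (Fin (n + 1)) K,
      (∀ i, Wt (f i) n (res.twist (k + 2) e)) →
      (∀ i j, X i * f j - X j * f i ∈ I) → ∃ g, ∀ i, X i * g - f i ∈ I) : False := by
  set a := res.twist (k + 2) e with ha
  have hI0 : ∀ f ∈ I, constantCoeff f = 0 := by
    intro f hf
    rw [← res.gen_span] at hf
    have : Ideal.span (Set.range res.gen) ≤ RingHom.ker (constantCoeff (R := K)
        (σ := Fin (n + 1))) := by
      rw [Ideal.span_le]
      rintro _ ⟨i, rfl⟩
      exact res.gen_min i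
    exact this hf
  have hmin : ∀ j, ∀ y ∈ LinearMap.range (res.mat j).mulVecLin, ∀ i, constantCoeff (y i) = 0 := by
    rintro j _ ⟨v, rfl⟩ i
    simp [Matrix.mulVec, dotProduct, res.mat_min]
  have hB : KH (unitSub I) (fun _ => 0) a (k + 1) := KH_base I a (k + 1) (by omega) hI0 hI
  let D0 : (Fin (res.rk 1) → MvPolynomial (Fin (n + 1)) K) →ₗ[MvPolynomial (Fin (n + 1)) K]
      (Unit → MvPolynomial (Fin (n + 1)) K) :=
    LinearMap.pi fun _ => Fintype.linearCombination _ res.gen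
  have hD0 : ∀ v u, D0 v u = ∑ i, v i * res.gen i := by
    intro v u; simp [D0, Fintype.linearCombination_apply]
  have hr : LinearMap.range D0 = unitSub I := by
    ext v
    constructor
    · rintro ⟨y, rfl⟩
      change D0 y () ∈ I
      rw [hD0]
      exact sum_mem fun i _ => Ideal.mul_mem_left _ _
        (res.gen_span.le (Ideal.subset_span ⟨i, rfl⟩))
    · intro hv
      change v () ∈ I at hv
      rw [← res.gen_span] at hv
      obtain ⟨c, hc⟩ := (Ideal.mem_span_range_iff_exists_fun).1 hv
      exact ⟨c, funext fun u => by rw [hD0, hc]⟩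
  have hker : LinearMap.ker D0 = LinearMap.range (res.mat 0).mulVecLin := by
    ext v
    rw [← res.exact_one, LinearMap.mem_ker]
    constructor
    · intro h; rw [← hD0 v (), h]; rfl
    · intro h; ext1 u; rw [hD0, h]; rfl
  have key : ∀ j p, j + p = k → KH (LinearMap.range (res.mat j).mulVecLin) (res.twist (j + 1)) a p := by
    intro j
    induction j with
    | zero =>
      intro p hp
      rw [← hker]
      refine KH_step D0 (fun _ => 0) (res.twist 1) a p ?_ ?_ ?_
      · intro y s hy u
        rw [hD0]
        apply Wt.sum
        intro i _
        rcases hy i with h | ⟨d, hd, h⟩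
        · left; simp [h]
        · exact Or.inr ⟨d + res.twist 1 i, hd.mul (res.gen_hom i), by omega⟩
      · rw [hker]; exact hmin 0
      · rw [hr]; convert hB using 1; omega
    | succ j ih =>
      intro p hp
      rw [← res.exact_rest]
      refine KH_step _ (res.twist (j + 1)) (res.twist (j + 2)) a p ?_ ?_ (ih (p + 1) (by omega))
      · intro y s hy i
        rw [Matrix.mulVecLin_apply, Matrix.mulVec, dotProduct]
        apply Wt.sum
        intro i' _
        rcases hy i' with h | ⟨d, hd, h⟩
        · left; simp [h]
        rcases res.mat_hom j i i' with h' | ⟨d', hd', h'⟩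
        · left; simp [h']
        · exact Or.inr ⟨d' + d, hd'.mul hd, by omega⟩
      · rw [res.exact_rest]; exact hmin (j + 1)
  have hinj : LinearMap.ker (res.mat k).mulVecLin = ⊥ := by
    rw [res.exact_rest, eq_bot_iff]
    rintro _ ⟨v, rfl⟩
    have h0 : res.rk (k + 3) = 0 := res.rk_eq_zero _ (by omega)
    have : IsEmpty (Fin (res.rk (k + 3))) := by rw [h0]; infer_instance
    have hv : v = 0 := Subsingleton.elim (α := Fin (res.rk (k + 3)) → _) _ _
    rw [hv, map_zero]; exact zero_mem _
  obtain ⟨w, hwU, hw⟩ := key k 0 rfl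
    (fun S => if S = ∅ then (res.mat k).mulVecLin (Pi.single e 1) else 0)
    (by
      intro S; split_ifs
      · exact ⟨_, rfl⟩
      · exact zero_mem _)
    (by
      intro S hS
      rw [if_neg]
      rintro rfl; simp at hS)
    (by
      intro S i
      split_ifs with hS
      · rw [Matrix.mulVecLin_apply, Matrix.mulVec_single_one]
        rcases res.mat_hom k i e with h | ⟨d, hd, h⟩
        · left; exact h
        · exact Or.inr ⟨d, hd, by rw [hS, Finset.card_empty]; omega⟩
      · exact Wt.zero _ _)
    (by
      ext1 S
      rw [kd_apply, Finset.sum_eq_zero]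
      · rfl
      intro i _
      simp [ann_apply])
  have h0 := congrFun hw ∅
  simp only [if_true] at h0
  choose u hu using hwU
  have ew : w = fun S => (res.mat k).mulVecLin (u S) := funext fun S => (hu S).symm
  rw [ew, kd_map] at h0
  have h1 : kd K u ∅ = Pi.single e 1 := (LinearMap.ker_eq_bot.mp hinj) h0
  have h2 := congrArg constantCoeff (congrFun h1 e)
  simp [kd_apply] at h2

end Res

section Geom

variable {n : ℕ}

/-- Linear form attached to a functional. -/
def lf (φ : Module.Dual K (Fin (n + 1) → K)) : MvPolynomial (Fin (n + 1)) K :=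
  ∑ i, C (φ (Pi.single i 1)) * X i

lemma eval_lf (φ : Module.Dual K (Fin (n + 1) → K)) (v : Fin (n + 1) → K) :
    eval v (lf φ) = φ v := by
  conv_rhs => rw [← Finset.univ_sum_single v]
  simp only [lf, map_sum, map_mul, eval_C, eval_X]
  refine Finset.sum_congr rfl fun i _ => ?_
  have : Pi.single i (v i) = v i • (Pi.single i 1 : Fin (n + 1) → K) := by
    rw [← Pi.single_smul]; simp
  rw [this, map_smul, smul_eq_mul, mul_comm]

lemma lf_hom (φ : Module.Dual K (Fin (n + 1) → K)) : (lf φ).IsHomogeneous 1 :=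
  IsHomogeneous.sum _ _ _ fun _ _ => isHomogeneous_C_mul_X _ _

lemma eval_smul_hom {f : MvPolynomial (Fin (n + 1)) K} {d : ℕ} (hf : f.IsHomogeneous d) (c : K)
    (v : Fin (n + 1) → K) : eval (c • v) f = c ^ d * eval v f := by
  rw [eval_eq, eval_eq, Finset.mul_sum]
  refine Finset.sum_congr rfl fun m hm => ?_
  have : ∑ i ∈ m.support, m i = d := by
    by_contra h
    exact (mem_support_iff.mp hm) (hf.coeff_eq_zero h)
  simp only [Pi.smul_apply, smul_eq_mul, mul_pow, Finset.prod_mul_distrib,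
    Finset.prod_pow_eq_pow_sum, this]
  ring

lemma mem_I {Γ : Set (Projectivization K (Fin (n + 1) → K))}
    {f : MvPolynomial (Fin (n + 1)) K} {d : ℕ} (hf : f.IsHomogeneous d)
    (h : ∀ P ∈ Γ, eval P.rep f = 0) : f ∈ vanishingIdeal Γ := by
  intro P hP v hv hvP
  have h1 : Projectivization.mk K v hv = Projectivization.mk K P.rep P.rep_nonzero := by
    rw [hvP, Projectivization.mk_rep]
  obtain ⟨c, rfl⟩ := (Projectivization.mk_eq_mk_iff' K _ _ _ _).mp h1
  rw [eval_smul_hom hf, h P hP, mul_zero]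

lemma eval_rep_eq_zero {Γ : Set (Projectivization K (Fin (n + 1) → K))}
    {f : MvPolynomial (Fin (n + 1)) K} (hf : f ∈ vanishingIdeal Γ)
    {P} (hP : P ∈ Γ) : eval P.rep f = 0 :=
  hf P hP P.rep P.rep_nonzero P.mk_rep

variable [DecidableEq (Projectivization K (Fin (n + 1) → K))]
  {Γ : Finset (Projectivization K (Fin (n + 1) → K))}

lemma dual_exists (hgen : ∀ Γ' ⊆ Γ, Γ'.card = n + 1 → Nondeg Γ')
    {T : Finset (Projectivization K (Fin (n + 1) → K))} (hT : T ⊆ Γ) (hTc : T.card = n + 1)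
    {P} (hP : P ∈ T) :
    ∃ φ : Module.Dual K (Fin (n + 1) → K), φ P.rep = 1 ∧ ∀ Q ∈ T, Q ≠ P → φ Q.rep = 0 := by
  classical
  let s : Finset (Fin (n + 1) → K) := (T.erase P).image Projectivization.rep
  have hlt : Submodule.span K (s : Set (Fin (n + 1) → K)) < ⊤ := by
    rw [lt_top_iff_ne_top]
    intro h
    have h1 := finrank_span_finset_le_card (R := K) s
    rw [Set.finrank, h, finrank_top, Module.finrank_fin_fun] at h1
    have h2 : s.card ≤ (T.erase P).card := Finset.card_image_le
    rw [Finset.card_erase_of_mem hP] at h2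
    omega
  obtain ⟨φ, hφ, hle⟩ := Submodule.exists_le_ker_of_lt_top _ hlt
  have hv : ∀ Q ∈ T, Q ≠ P → φ Q.rep = 0 := by
    intro Q hQ hne
    apply hle
    apply Submodule.subset_span
    simp only [s, Finset.coe_image]
    exact ⟨Q, by simp [hQ, hne], rfl⟩
  have hP0 : φ P.rep ≠ 0 := by
    intro h0
    apply hφ
    refine hgen T hT hTc φ fun Q hQ => ?_
    by_cases hne : Q = P
    · rw [hne, h0]
    · exact hv Q hQ hne
  refine ⟨(φ P.rep)⁻¹ • φ, by simp [hP0], fun Q hQ hne => by simp [hv Q hQ hne]⟩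

lemma dual_two (hcard : Γ.card = n + 2) (hgen : ∀ Γ' ⊆ Γ, Γ'.card = n + 1 → Nondeg Γ')
    {P Q} (hP : P ∈ Γ) (hQ : Q ∈ Γ) (hPQ : P ≠ Q) :
    ∃ φ : Module.Dual K (Fin (n + 1) → K), φ P.rep = 1 ∧ φ Q.rep ≠ 0 ∧
      ∀ R ∈ Γ, R ≠ P → R ≠ Q → φ R.rep = 0 := by
  obtain ⟨φ, h1, h2⟩ := dual_exists hgen (Finset.erase_subset Q Γ)
    (by rw [Finset.card_erase_of_mem hQ]; omega) (P := P) (by simp [hP, hPQ])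
  have h3 : ∀ R ∈ Γ, R ≠ P → R ≠ Q → φ R.rep = 0 := fun R hR hRP hRQ =>
    h2 R (by simp [hR, hRQ]) hRP
  refine ⟨φ, h1, fun h0 => ?_, h3⟩
  have : φ = 0 := by
    refine hgen (Γ.erase P) (Finset.erase_subset P Γ)
      (by rw [Finset.card_erase_of_mem hP]; omega) φ fun R hR => ?_
    rw [Finset.mem_erase] at hR
    by_cases hRQ : R = Q
    · rw [hRQ, h0]
    · exact h3 R hR.2 hR.1 hRQ
  rw [this] at h1
  simp at h1

lemma dual_sep (hn : 1 ≤ n) (hcard : Γ.card = n + 2)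
    (hgen : ∀ Γ' ⊆ Γ, Γ'.card = n + 1 → Nondeg Γ')
    {P Q} (hP : P ∈ Γ) (hQ : Q ∈ Γ) (hPQ : P ≠ Q) :
    ∃ φ : Module.Dual K (Fin (n + 1) → K), φ P.rep = 1 ∧ φ Q.rep = 0 := by
  obtain ⟨R, hR, hRn⟩ := Finset.exists_mem_notMem_of_card_lt_card (s := {P, Q}) (t := Γ)
    (lt_of_le_of_lt Finset.card_le_two (by omega))
  simp only [Finset.mem_insert, Finset.mem_singleton, not_or] at hRn
  obtain ⟨φ, h1, h2⟩ := dual_exists hgen (Finset.erase_subset R Γ)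
    (by rw [Finset.card_erase_of_mem hR]; omega) (P := P) (by simp [hP, Ne.symm hRn.1])
  exact ⟨φ, h1, h2 Q (by simp [hQ, Ne.symm hRn.2]) hPQ.symm⟩

lemma interp (hn : 1 ≤ n) (hcard : Γ.card = n + 2)
    (hgen : ∀ Γ' ⊆ Γ, Γ'.card = n + 1 → Nondeg Γ') {P} (hP : P ∈ Γ) (e : ℕ) :
    ∃ g : MvPolynomial (Fin (n + 1)) K, g.IsHomogeneous (e + 2) ∧ eval P.rep g = 1 ∧
      ∀ Q ∈ Γ, Q ≠ P → eval Q.rep g = 0 := by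
  obtain ⟨Q, hQ, hPQ⟩ := Finset.exists_mem_ne (s := Γ) (by omega) P
  obtain ⟨φ, h1, -, h2⟩ := dual_two hcard hgen hP hQ hPQ.symm
  obtain ⟨ψ, h3, h4⟩ := dual_sep hn hcard hgen hP hQ hPQ.symm
  refine ⟨lf φ ^ (e + 1) * lf ψ, ?_, ?_, ?_⟩
  · have := ((lf_hom φ).pow (e + 1)).mul (lf_hom ψ)
    convert this using 1; ring
  · simp [eval_lf, h1, h3]
  · intro R hR hRP
    by_cases hRQ : R = Q
    · simp [eval_lf, hRQ, h4]
    · simp [eval_lf, h2 R hR hRP hRQ]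

lemma geom (hn : 1 ≤ n) (hcard : Γ.card = n + 2)
    (hgen : ∀ Γ' ⊆ Γ, Γ'.card = n + 1 → Nondeg Γ') (a : ℕ) (ha : a ≠ n + 2)
    (f : Fin (n + 1) → MvPolynomial (Fin (n + 1)) K) (hf : ∀ i, Wt (f i) n a)
    (hI : ∀ i j, X i * f j - X j * f i ∈
      vanishingIdeal (Γ : Set (Projectivization K (Fin (n + 1) → K)))) :
    ∃ g, ∀ i, X i * g - f i ∈
      vanishingIdeal (Γ : Set (Projectivization K (Fin (n + 1) → K))) := by
  -- eigenvalues
  have hlam : ∀ P : Projectivization K (Fin (n + 1) → K), ∃ l : K, P ∈ Γ →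
      ∀ i, eval P.rep (f i) = l * P.rep i := by
    intro P
    obtain ⟨k, hk⟩ : ∃ k, P.rep k ≠ 0 := by
      by_contra! h
      exact P.rep_nonzero (funext h)
    refine ⟨eval P.rep (f k) / P.rep k, fun hP i => ?_⟩
    have := eval_rep_eq_zero (hI k i) (P := P) (by simpa using hP)
    simp only [map_sub, map_mul, eval_X] at this
    field_simp
    linear_combination this
  choose l hl using hlam
  by_cases han : a < n
  · refine ⟨0, fun i => ?_⟩
    rcases hf i with h | ⟨d, hd, h⟩
    · simp [h]
    · omega
  obtain ⟨d, rfl⟩ : ∃ d, a = d + n := ⟨a - n, by omega⟩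
  have hfd : ∀ i, (f i).IsHomogeneous d := by
    intro i
    rcases hf i with h | ⟨d', hd, h⟩
    · rw [h]; exact isHomogeneous_zero _ _ _
    · obtain rfl : d' = d := by omega
      exact hd
  obtain rfl | rfl | ⟨e, rfl⟩ : d = 0 ∨ d = 1 ∨ ∃ e, d = e + 3 := by
    by_cases h0 : d = 0
    · exact Or.inl h0
    by_cases h1 : d = 1
    · exact Or.inr (Or.inl h1)
    · exact Or.inr (Or.inr ⟨d - 3, by omega⟩)
  · -- constants
    refine ⟨0, fun i => ?_⟩
    have : (X i * 0 - f i).IsHomogeneous 0 := by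
      rw [mul_zero, zero_sub]; exact (hfd i).neg
    refine mem_I this fun P hP => ?_
    have hP' : P ∈ Γ := by simpa using hP
    obtain ⟨Q, hQ, hPQ⟩ := Finset.exists_mem_ne (s := Γ) (by omega) P
    obtain ⟨φ, h1, h2⟩ := dual_sep hn hcard hgen hP' hQ hPQ.symm
    have hc : ∀ j, ∀ v w, eval v (f j) = eval w (f j) := by
      intro j v w
      have := hfd j
      rw [← totalDegree_zero_iff_isHomogeneous, totalDegree_eq_zero_iff_eq_C] at this
      rw [this]; simp
    have hvec : l P • P.rep = l Q • Q.rep := by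
      ext j
      simp only [Pi.smul_apply, smul_eq_mul]
      rw [← hl P hP' j, ← hl Q hQ j]
      exact hc j _ _
    have := congrArg φ hvec
    rw [map_smul, map_smul, h1, h2] at this
    simp only [smul_eq_mul, mul_one, mul_zero] at this
    simp [hl P hP' i, this]
  · -- linear forms
    have hconst : ∀ P ∈ Γ, ∀ Q ∈ Γ, l P = l Q := by
      intro P hP Q hQ
      by_cases hPQ : P = Q
      · rw [hPQ]
      obtain ⟨φ, h1, h2, h3⟩ := dual_two hcard hgen hP hQ hPQ
      let h : MvPolynomial (Fin (n + 1)) K :=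
        ∑ i, C (φ (Pi.single i 1)) * f i - C (l P) * lf φ
      have hh : h.IsHomogeneous 1 :=
        (IsHomogeneous.sum _ _ _ fun i _ => (hfd i).C_mul _).sub ((lf_hom φ).C_mul _)
      have hev : ∀ R ∈ Γ, eval R.rep h = (l R - l P) * φ R.rep := by
        intro R hR
        have e1 := eval_lf φ R.rep
        simp only [lf, map_sum, map_mul, eval_C, eval_X] at e1
        simp only [h, map_sub, map_sum, map_mul, eval_C, eval_lf, hl R hR]
        rw [sub_mul]
        congr 1
        rw [← e1, Finset.mul_sum]
        refine Finset.sum_congr rfl fun i _ => by ring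
      -- the functional given by `h`
      let ψ : Module.Dual K (Fin (n + 1) → K) :=
        { toFun := fun v => eval v h
          map_add' := by
            intro v w
            have hs := homogeneousSubmodule_one_eq_span_X (σ := Fin (n + 1)) (R := K)
            have hm : h ∈ Submodule.span K (Set.range (X : Fin (n + 1) → MvPolynomial _ K)) := by
              rw [← hs]; exact hh
            refine Submodule.span_induction ?_ ?_ ?_ ?_ hm
            · rintro _ ⟨i, rfl⟩; simp
            · simp
            · intro x y _ _ hx hy; simp only [map_add, hx, hy]; ring
            · intro c x _ hx; simp only [smul_eval, hx]; ring
          map_smul' := by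
            intro c v
            rw [eval_smul_hom hh]; simp }
      have hψ : ψ = 0 := by
        refine hgen (Γ.erase Q) (Finset.erase_subset Q Γ)
          (by rw [Finset.card_erase_of_mem hQ]; omega) ψ fun R hR => ?_
        rw [Finset.mem_erase] at hR
        change eval R.rep h = 0
        rw [hev R hR.2]
        by_cases hRP : R = P
        · simp [hRP]
        · rw [h3 R hR.2 hRP hR.1, mul_zero]
      have h4 : ψ Q.rep = 0 := by rw [hψ]; rfl
      change eval Q.rep h = 0 at h4
      rw [hev Q hQ] at h4
      rcases mul_eq_zero.mp h4 with h5 | h5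
      · exact (sub_eq_zero.mp h5).symm
      · exact absurd h5 h2
    obtain ⟨P0, hP0⟩ : Γ.Nonempty := Finset.card_pos.mp (by omega)
    refine ⟨C (l P0), fun i => ?_⟩
    have : (X i * C (l P0) - f i).IsHomogeneous 1 :=
      ((isHomogeneous_X K i).mul (isHomogeneous_C _ _)).sub (hfd i)
    refine mem_I this fun P hP => ?_
    have hP' : P ∈ Γ := by simpa using hP
    simp only [map_sub, map_mul, eval_X, eval_C, hl P hP', hconst P hP' P0 hP0]
    ring
  · -- interpolation
    have hg : ∀ P : Projectivization K (Fin (n + 1) → K), ∃ g : MvPolynomial (Fin (n + 1)) K,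
        P ∈ Γ → g.IsHomogeneous (e + 2) ∧ eval P.rep g = 1 ∧
        ∀ Q ∈ Γ, Q ≠ P → eval Q.rep g = 0 := by
      intro P
      by_cases hP : P ∈ Γ
      · obtain ⟨g, hg⟩ := interp hn hcard hgen hP e
        exact ⟨g, fun _ => hg⟩
      · exact ⟨0, fun h => absurd h hP⟩
    choose g hg using hg
    refine ⟨∑ P ∈ Γ, C (l P) * g P, fun i => ?_⟩
    have : (X i * (∑ P ∈ Γ, C (l P) * g P) - f i).IsHomogeneous (e + 3) := by
      refine IsHomogeneous.sub ?_ (hfd i)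
      have := (isHomogeneous_X K i).mul
        (IsHomogeneous.sum Γ (fun P => C (l P) * g P) (e + 2) fun P hP => (hg P hP).1.C_mul _)
      rw [show e + 3 = 1 + (e + 2) by omega]
      exact this
    refine mem_I this fun P hP => ?_
    have hP' : P ∈ Γ := by simpa using hP
    simp only [map_sub, map_mul, eval_X, eval_C, map_sum, hl P hP']
    rw [Finset.sum_eq_single P]
    · rw [(hg P hP').2.1]; ring
    · intro Q hQ hne
      rw [(hg Q hQ).2.2 P hP' hne.symm, mul_zero]
    · intro h; exact absurd hP' h

lemma hyp_eq (hcard : Γ.card = n + 2)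
    (hgen : ∀ Γ' ⊆ Γ, Γ'.card = n + 1 → Nondeg Γ') : hyp Γ = n := by
  classical
  have hle : ∀ φ : Module.Dual K (Fin (n + 1) → K), φ ≠ 0 →
      ∀ T ⊆ Γ, (∀ P ∈ T, φ P.rep = 0) → T.card ≤ n := by
    intro φ hφ T hT h
    by_contra! hc
    obtain ⟨T', hT', hc'⟩ := Finset.exists_subset_card_eq (s := T) (n := n + 1) hc
    exact hφ (hgen T' (hT'.trans hT) hc' φ fun P hP => h P (hT' hP))
  unfold hyp
  apply IsGreatest.csSup_eq
  constructor
  · obtain ⟨P, hP, Q, hQ, hPQ⟩ := Finset.one_lt_card.mp (show 1 < Γ.card by omega)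
    obtain ⟨φ, h1, h2, h3⟩ := dual_two hcard hgen hP hQ hPQ
    have h0 : φ ≠ 0 := by rintro rfl; simp at h1
    refine ⟨φ, h0, le_antisymm ?_ (hle φ h0 _ (Finset.filter_subset _ _) fun P hP =>
      (Finset.mem_filter.mp hP).2)⟩
    have hs : (Γ.erase P).erase Q ⊆ Γ.filter fun P => φ P.rep = 0 := by
      intro R hR
      simp only [Finset.mem_erase] at hR
      exact Finset.mem_filter.mpr ⟨hR.2.2, h3 R hR.2.2 hR.2.1 hR.1⟩
    have hc := Finset.card_le_card hs
    rw [Finset.card_erase_of_mem (by simp [hQ, hPQ.symm]), Finset.card_erase_of_mem hP, hcard] at hc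
    have hc2 : n ≤ (Γ.filter fun P => φ P.rep = 0).card := by omega
    convert hc2
  · rintro _ ⟨φ, h0, rfl⟩
    exact hle φ h0 _ (Finset.filter_subset _ _) fun P hP => (Finset.mem_filter.mp hP).2

end Geom
/-- For a generic set `Γ` of `n + 2` points of `P^n`
(no `n + 1` of them in a hyperplane), `hyp(Γ) = n`, `d(Γ) = 2`, and the
minimum socle degree satisfies `A_n = 2`, so `d(Γ) = A_n`. -/
theorem generic_n_add_two_points
    {K : Type} [Field K] [CharZero K] {n : ℕ} (hn : 2 ≤ n)
    (Γ : Finset (Projectivization K (Fin (n + 1) → K)))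
    (hcard : Γ.card = n + 2)
    (hgen : ∀ Γ' ⊆ Γ, Γ'.card = n + 1 → Nondeg Γ')
    (res : MinFreeRes (n + 1) K (vanishingIdeal (Γ : Set (Projectivization K (Fin (n + 1) → K)))))
    (hlen : res.len = n) :
    hyp Γ = n ∧ minDist Γ = 2 ∧ res.A = 2 ∧ (minDist Γ : ℤ) = res.A := by
  classical
  have h1 : hyp Γ = n := hyp_eq hcard hgen
  have h2 : minDist Γ = 2 := by unfold minDist; rw [h1, hcard]; omega
  have h3 : ∀ L, L = n → L = res.len → ∀ i : Fin (res.rk L), res.twist L i = n + 2 := by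
    intro L hL hL' e
    obtain ⟨k, rfl⟩ : ∃ k, L = k + 2 := ⟨L - 2, by omega⟩
    by_contra hne
    exact main_res res hL.symm hL'.symm e fun f hf hI =>
      geom (by omega) hcard hgen _ hne f hf hI
  have h4 : res.aMin = n + 2 := by
    unfold MinFreeRes.aMin
    simp only [h3 res.len hlen rfl]
    exact Finset.inf'_const _ _
  have h5 : res.A = 2 := by
    unfold MinFreeRes.A; rw [h4, hlen]; push_cast; ring
  exact ⟨h1, h2, h5, by rw [h2, h5]; rfl⟩

end PointsMinDist
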